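/- Let p be a prime. The degree-3 group cohomology H³((ℤ/p)²; ℤ) of the rank-2 elementary abelian p-group (ℤ/p)² with trivial ℤ-coefficients is a cyclic group of order p, i.e., it is isomorphic as an abelian group to ℤ/p. -/

import Mathlib

open CategoryTheory Limits

/-- A symmetric 2-cocycle of a commutative group with values in a divisible group
(with trivial action) is a coboundary. -/
theorem exists_eq_add_sub_of_symmetric_cocycle {A G : Type*} [AddCommGroup A] [DivisibleBy A ℤ]
    [CommGroup G] (f : G → G → A) (hsymm : ∀ g h, f g h = f h g)
    (hf : ∀ g h j, f (g * h) j + f g h = f h j + f g (h * j)) :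
    ∃ s : G → A, ∀ g h, f g h = s h - s (g * h) + s g := by
  have h1 (g : G) : f 1 g = f 1 1 := by simpa using (hf 1 1 g).symm
  let : Add (A × G) := ⟨fun x y ↦ (x.1 + y.1 + f x.2 y.2, x.2 * y.2)⟩
  let : Zero (A × G) := ⟨(-f 1 1, 1)⟩
  let : Neg (A × G) := ⟨fun x ↦ (-x.1 - f x.2⁻¹ x.2 - f 1 1, x.2⁻¹)⟩
  have add_def (x y : A × G) : x + y = (x.1 + y.1 + f x.2 y.2, x.2 * y.2) := rfl
  have zero_def : (0 : A × G) = (-f 1 1, 1) := rfl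
  have neg_def (x : A × G) : -x = (-x.1 - f x.2⁻¹ x.2 - f 1 1, x.2⁻¹) := rfl
  let : AddCommGroup (A × G) :=
    { AddGroup.ofLeftAxioms (G := A × G)
        (fun x y z ↦ by
          ext
          · simp only [add_def]
            calc x.1 + y.1 + f x.2 y.2 + z.1 + f (x.2 * y.2) z.2
                = x.1 + y.1 + z.1 + (f (x.2 * y.2) z.2 + f x.2 y.2) := by abel
              _ = x.1 + (y.1 + z.1 + f y.2 z.2) + f x.2 (y.2 * z.2) := by rw [hf]; abel
          · simp only [add_def, mul_assoc])
        (fun x ↦ by simp [add_def, zero_def, h1])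
        (fun x ↦ by
          simp only [add_def, zero_def, neg_def, inv_mul_cancel, Prod.mk.injEq, and_true]
          abel) with
      add_comm := fun x y ↦ by simp only [add_def, hsymm x.2, mul_comm x.2, add_comm x.1] }
  let i : A →+ A × G := AddMonoidHom.mk' (fun a ↦ (a - f 1 1, 1)) fun a b ↦ by
    change _ = (_, _)
    simp only [mul_one, Prod.mk.injEq, and_true]
    abel
  have hi : Function.Injective i.toIntLinearMap := fun a b h ↦ by
    simpa [i] using congrArg Prod.fst h
  obtain ⟨r, hr⟩ := (Module.Baer.of_divisible A).extension_property i.toIntLinearMap hi .id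
  refine ⟨fun g ↦ r (0, g), fun g h ↦ ?_⟩
  have key : ((0, g) : A × G) + (0, h) = i (f g h) + (0, g * h) := by
    change (_, _) = (_, _)
    simp [i, h1]
  have := congrArg r key
  rw [map_add, map_add, show r (i (f g h)) = f g h from LinearMap.congr_fun hr _] at this
  rw [eq_sub_of_add_eq this.symm]
  abel

namespace groupCohomology

/-- The group cohomology of a finite group with trivial real coefficients vanishes in positive
degrees. -/
theorem isZero_trivial_real_succ (G : Type) [Group G] [Finite G] (n : ℕ) :
    IsZero (groupCohomology (Rep.trivial ℤ G ℝ) (n + 1)) := by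
  have := Fintype.ofFinite G
  let B : Rep ℤ (⊥ : Subgroup G) := Rep.trivial ℤ (⊥ : Subgroup G) ℝ
  have hC : IsZero (groupCohomology (Rep.coind (⊥ : Subgroup G).subtype B) (n + 1)) :=
    (isZero_groupCohomology_succ_of_subsingleton B n).of_iso (coindIso B (n + 1))
  let i : Rep.trivial ℤ G ℝ ⟶ Rep.coind (⊥ : Subgroup G).subtype B :=
    Rep.resCoindToHom _ _ _ (𝟙 _)
  let r : Rep.coind (⊥ : Subgroup G).subtype B ⟶ Rep.trivial ℤ G ℝ :=
    Rep.ofHom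
      { toFun f := (Fintype.card G : ℝ)⁻¹ * ∑ g : G, (f.1 g : ℝ)
        map_add' f g := by
          change (Fintype.card G : ℝ)⁻¹ * ∑ x : G, ((f.1 x : ℝ) + g.1 x) = _
          rw [Finset.sum_add_distrib, mul_add]
        map_smul' c f := by
          change (Fintype.card G : ℝ)⁻¹ * ∑ x : G, (c • (f.1 x : ℝ)) = _
          rw [← Finset.smul_sum, mul_smul_comm]
          rfl
        isIntertwining' g := by
          ext f
          change (Fintype.card G : ℝ)⁻¹ * ∑ x : G, (f.1 (x * g) : ℝ) =
            (Fintype.card G : ℝ)⁻¹ * ∑ x : G, (f.1 x : ℝ)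
          congr 1
          exact Fintype.sum_equiv (Equiv.mulRight g) _ _ fun _ ↦ rfl }
  have hir : i ≫ r = 𝟙 _ := by
    ext x
    change (Fintype.card G : ℝ)⁻¹ * ∑ g : G, (x : ℝ) = x
    simp
  rw [IsZero.iff_id_eq_zero]
  have h := congrArg (functor ℤ G (n + 1)).map hir
  rw [CategoryTheory.Functor.map_comp, CategoryTheory.Functor.map_id] at h
  refine Eq.trans h.symm ?_
  exact hC.eq_zero_of_tgt ((functor ℤ G (n + 1)).map i) ▸ zero_comp

theorem _root_.Rep.exact_of_forall_exists {k G : Type*} [CommRing k] [Group G]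
    (S : ShortComplex (Rep k G)) (h : ∀ x : S.X₂, S.g.hom x = 0 → ∃ y : S.X₁, S.f.hom y = x) :
    S.Exact :=
  (forget₂ (Rep k G) (ModuleCat k)).reflects_exact_of_faithful _ <|
    (ShortComplex.moduleCat_exact_iff _).2 h

/-- The short exact sequence `0 ⟶ ℤ ⟶ ℝ ⟶ ℝ/ℤ ⟶ 0` of trivial representations of `G`. -/
noncomputable def intRealCircle (G : Type) [Group G] : ShortComplex (Rep ℤ G) where
  X₁ := Rep.trivial ℤ G ℤ
  X₂ := Rep.trivial ℤ G ℝ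
  X₃ := Rep.trivial ℤ G UnitAddCircle
  f := Rep.ofHom ⟨(Int.castAddHom ℝ).toIntLinearMap, fun _ ↦ rfl⟩
  g := Rep.ofHom ⟨(QuotientAddGroup.mk' (AddSubgroup.zmultiples (1 : ℝ))).toIntLinearMap,
    fun _ ↦ rfl⟩
  zero := by
    ext
    change ((((1 : ℤ) : ℝ) : UnitAddCircle)) = 0
    simp

theorem intRealCircle_shortExact (G : Type) [Group G] : (intRealCircle G).ShortExact where
  mono_f := (Rep.mono_iff_injective _).2 (Int.cast_injective (α := ℝ))
  epi_g := (Rep.epi_iff_surjective _).2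
    (QuotientAddGroup.mk'_surjective (AddSubgroup.zmultiples (1 : ℝ)))
  exact := by
    apply Rep.exact_of_forall_exists
    intro (x : ℝ) (hx : (x : UnitAddCircle) = 0)
    obtain ⟨n, hn⟩ := (AddCircle.coe_eq_zero_iff (1 : ℝ)).1 hx
    exact ⟨n, show ((n : ℤ) : ℝ) = x by simpa using hn⟩

end groupCohomology

theorem ZMod.mem_range_toAddCircle {N : ℕ} [NeZero N] {u : UnitAddCircle} (hu : N • u = 0) :
    ∃ j : ZMod N, ZMod.toAddCircle j = u := by
  obtain ⟨m, -, h⟩ := (AddCircle.nsmul_eq_zero_iff (NeZero.pos N)).1 hu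
  exact ⟨m, by rw [ZMod.toAddCircle_natCast, ← h]; simp⟩

namespace groupCohomology

variable {p : ℕ}

/-- The 2-cocycle `(a, b), (c, d) ↦ kad / p` of `(ℤ/p)²` with values in `ℝ/ℤ`. -/
noncomputable def cupCocycle (p : ℕ) [NeZero p] :
    ZMod p →+ cocycles₂ (Rep.trivial ℤ (Multiplicative (ZMod p × ZMod p)) UnitAddCircle) where
  toFun k := ⟨fun x ↦ ZMod.toAddCircle (k * (x.1.toAdd.1 * x.2.toAdd.2)), by
    rw [mem_cocycles₂_iff]
    intro g h j
    change ZMod.toAddCircle _ + ZMod.toAddCircle _ = ZMod.toAddCircle _ + ZMod.toAddCircle _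
    simp only [← map_add, toAdd_mul, Prod.fst_add, Prod.snd_add]
    congr 1
    ring⟩
  map_zero' := by
    apply cocycles₂_ext
    intro g h
    change ZMod.toAddCircle _ = 0
    rw [zero_mul, map_zero]
  map_add' k l := by
    apply cocycles₂_ext
    intro g h
    change ZMod.toAddCircle _ = ZMod.toAddCircle _ + ZMod.toAddCircle _
    rw [← map_add, add_mul]

section Commutator

variable {G A : Type} [CommGroup G] [AddCommGroup A]

theorem cocycle₂_trivial (f : cocycles₂ (Rep.trivial ℤ G A)) (g h j : G) :
    (f (g * h, j) + f (g, h) : A) = f (h, j) + f (g, h * j) :=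
  (mem_cocycles₂_iff f).1 f.2 g h j

/-- The commutator pairing `(g, h) ↦ f (g, h) - f (h, g)` of a 2-cocycle `f` of a commutative
group with trivial coefficients, as a homomorphism in the second variable. -/
def commutatorPairing (f : cocycles₂ (Rep.trivial ℤ G A)) (g : G) : Additive G →+ A :=
  AddMonoidHom.mk' (fun h ↦ (f (g, h.toMul) - f (h.toMul, g) : A)) fun h j ↦ by
    have e₁ := cocycle₂_trivial f g h.toMul j.toMul
    have e₂ := cocycle₂_trivial f h.toMul g j.toMul
    have e₃ := cocycle₂_trivial f h.toMul j.toMul g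
    rw [mul_comm h.toMul g] at e₂
    rw [mul_comm j.toMul g] at e₃
    simp only [toMul_add]
    generalize h.toMul = x at *
    generalize j.toMul = y at *
    have e₁' : (f (g, x * y) : A) = f (g * x, y) + f (g, x) - f (x, y) := by rw [e₁]; abel
    have e₂' : (f (g * x, y) : A) = f (g, y) + f (x, g * y) - f (x, g) := by rw [← e₂]; abel
    have e₃' : (f (x * y, g) : A) = f (y, g) + f (x, g * y) - f (x, y) := by rw [← e₃]; abel
    rw [e₁', e₂', e₃']
    abel

theorem commutatorPairing_apply (f : cocycles₂ (Rep.trivial ℤ G A)) (g h : G) :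
    commutatorPairing f g (.ofMul h) = (f (g, h) - f (h, g) : A) := rfl

theorem commutatorPairing_swap (f : cocycles₂ (Rep.trivial ℤ G A)) (g h : G) :
    commutatorPairing f g (.ofMul h) = -commutatorPairing f h (.ofMul g) := by
  rw [commutatorPairing_apply, commutatorPairing_apply, neg_sub]

theorem mem_coboundaries₂_of_commutatorPairing_eq_zero [DivisibleBy A ℤ]
    (f : cocycles₂ (Rep.trivial ℤ G A)) (hf : ∀ g, commutatorPairing f g = 0) :
    ⇑f ∈ coboundaries₂ (Rep.trivial ℤ G A) := by
  obtain ⟨s, hs⟩ := exists_eq_add_sub_of_symmetric_cocycle (A := A) (fun g h ↦ f (g, h))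
    (fun g h ↦ sub_eq_zero.1 (DFunLike.congr_fun (hf g) (.ofMul h))) (cocycle₂_trivial f)
  exact ⟨s, funext fun x ↦ (hs x.1 x.2).symm⟩

theorem commutatorPairing_eq_zero_of_mem_coboundaries₂
    (f : cocycles₂ (Rep.trivial ℤ G A)) (hf : ⇑f ∈ coboundaries₂ (Rep.trivial ℤ G A)) (g : G) :
    commutatorPairing f g = 0 := by
  obtain ⟨s, hs⟩ := hf
  have hs' (x y : G) : (f (x, y) : A) = s y - s (x * y) + s x := (congrFun hs (x, y)).symm
  refine AddMonoidHom.ext fun h ↦ ?_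
  change (f (g, h.toMul) - f (h.toMul, g) : A) = 0
  rw [hs', hs', mul_comm h.toMul]
  abel

end Commutator

/-- A commutator pairing on `(ℤ/p)²` vanishes if it vanishes on the two standard generators. -/
theorem commutatorPairing_eq_zero {A : Type} [AddCommGroup A]
    (f : cocycles₂ (Rep.trivial ℤ (Multiplicative (ZMod p × ZMod p)) A))
    (hf : commutatorPairing f (.ofAdd (1, 0)) (.ofMul (.ofAdd (0, 1))) = 0)
    (g : Multiplicative (ZMod p × ZMod p)) : commutatorPairing f g = 0 := by
  have hext (φ : Additive (Multiplicative (ZMod p × ZMod p)) →+ A)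
      (h₁ : φ (.ofMul (.ofAdd (1, 0))) = 0) (h₂ : φ (.ofMul (.ofAdd (0, 1))) = 0) : φ = 0 := by
    refine AddMonoidHom.ext fun x ↦ ?_
    obtain ⟨a, ha⟩ := ZMod.intCast_surjective x.toMul.toAdd.1
    obtain ⟨b, hb⟩ := ZMod.intCast_surjective x.toMul.toAdd.2
    have : x = a • Additive.ofMul (Multiplicative.ofAdd ((1, 0) : ZMod p × ZMod p)) +
        b • Additive.ofMul (Multiplicative.ofAdd (0, 1)) := by
      change x.toMul.toAdd = a • ((1, 0) : ZMod p × ZMod p) + b • ((0, 1) : ZMod p × ZMod p)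
      ext <;> simp [ha, hb]
    rw [this, map_add, map_zsmul, map_zsmul, h₁, h₂]
    simp
  have h₁ : commutatorPairing f (.ofAdd (1, 0)) = 0 := hext _ (sub_self _) hf
  have h₂ : commutatorPairing f (.ofAdd (0, 1)) = 0 :=
    hext _ (by rw [commutatorPairing_swap, hf, neg_zero]) (sub_self _)
  refine hext _ ?_ ?_ <;> rw [commutatorPairing_swap]
  · simp [h₁]
  · simp [h₂]

theorem bijective_H2π_comp_cupCocycle (p : ℕ) [NeZero p] :
    Function.Bijective ((H2π (Rep.trivial ℤ (Multiplicative (ZMod p × ZMod p))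
      UnitAddCircle)).hom.toAddMonoidHom.comp (cupCocycle p)) := by
  have hval (k : ZMod p) : commutatorPairing (cupCocycle p k) (.ofAdd (1, 0))
      (.ofMul (.ofAdd (0, 1))) = ZMod.toAddCircle k := by
    change ZMod.toAddCircle (k * (1 * 1)) - ZMod.toAddCircle (k * (0 * 0)) = _
    simp
  constructor
  · rw [injective_iff_map_eq_zero]
    intro k hk
    have := commutatorPairing_eq_zero_of_mem_coboundaries₂ _
      ((H2π_eq_zero_iff (cupCocycle p k)).1 hk) (.ofAdd (1, 0))
    rw [← ZMod.toAddCircle_eq_zero, ← hval, this]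
    rfl
  · intro x
    induction x using H2_induction_on with | h f =>
    obtain ⟨k, hk⟩ := ZMod.mem_range_toAddCircle (N := p)
      (u := commutatorPairing f (.ofAdd (1, 0)) (.ofMul (.ofAdd (0, 1)))) (by
        rw [← map_nsmul, ← ofMul_pow, ← ofAdd_nsmul,
          show p • ((0, 1) : ZMod p × ZMod p) = 0 by simp]
        exact map_zero _)
    refine ⟨k, (H2π_eq_iff _ _).2 ?_⟩
    refine mem_coboundaries₂_of_commutatorPairing_eq_zero (cupCocycle p k - f)
      (commutatorPairing_eq_zero _ ?_)
    have hsub : commutatorPairing (cupCocycle p k - f) (.ofAdd (1, 0)) (.ofMul (.ofAdd (0, 1))) =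
        commutatorPairing (cupCocycle p k) (.ofAdd (1, 0)) (.ofMul (.ofAdd (0, 1))) -
          commutatorPairing f (.ofAdd (1, 0)) (.ofMul (.ofAdd (0, 1))) :=
      sub_sub_sub_comm ..
    rw [hsub, hval, hk, sub_self]

end groupCohomology



/-- For a prime `p`, the degree-3 group cohomology of `(ℤ/p)²` with trivial `ℤ`-coefficients
is a cyclic group of order `p`, i.e. isomorphic as an abelian group to `ℤ/p`. -/
theorem stmt_3 (p : ℕ) (hp : p.Prime) :
    Nonempty
      ((groupCohomology
          (Rep.trivial ℤ (Multiplicative (ZMod p × ZMod p)) ℤ) 3) ≃+ ZMod p) := by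
  have : NeZero p := ⟨hp.ne_zero⟩
  have := groupCohomology.isIso_δ_of_isZero
    (groupCohomology.intRealCircle_shortExact (Multiplicative (ZMod p × ZMod p))) 2
    (groupCohomology.isZero_trivial_real_succ _ 1) (groupCohomology.isZero_trivial_real_succ _ 2)
  let e := (asIso (groupCohomology.δ (groupCohomology.intRealCircle_shortExact
    (Multiplicative (ZMod p × ZMod p))) 2 3 rfl)).toLinearEquiv.toAddEquiv
  exact ⟨e.symm.trans (AddEquiv.ofBijective _
    (groupCohomology.bijective_H2π_comp_cupCocycle p)).symm⟩
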